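/- Let J be the superalgebra (2,2)₅. Every supersymmetric 2-cocycle h : J × J → J is a coboundary; that is, the second cohomology group H²(J,J) vanishes. -/

import Mathlib

namespace JS22

variable (F : Type*) [Field F] [CharZero F]

/-- The underlying ℤ₂-graded vector space `J = F⁴`: coordinates `0,1` are the even
basis vectors `e₁, e₂` and coordinates `2,3` are the odd basis vectors `f₁, f₂`. -/
abbrev J : Type _ := Fin 4 → F

def e1 : J F := ![1, 0, 0, 0]
def e2 : J F := ![0, 1, 0, 0]
def f1 : J F := ![0, 0, 1, 0]
def f2 : J F := ![0, 0, 0, 1]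

/-- The even part `J₀ = span {e₁, e₂}`. -/
def J0 : Submodule F (J F) := Submodule.span F {e1 F, e2 F}

/-- The odd part `J₁ = span {f₁, f₂}`. -/
def J1 : Submodule F (J F) := Submodule.span F {f1 F, f2 F}

/-- `x` is homogeneous of degree `d ∈ {0, 1}`. -/
def IsHomog (x : J F) (d : ℕ) : Prop :=
  (d = 0 ∧ x ∈ J0 F) ∨ (d = 1 ∧ x ∈ J1 F)

/-- A (bilinear) multiplication is supercommutative: `x y = (−1)^{|x||y|} y x`. -/
def IsSuperComm (mul : J F → J F → J F) : Prop :=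
  ∀ x y : J F, ∀ dx dy : ℕ, IsHomog F x dx → IsHomog F y dy →
    mul x y = ((-1 : F) ^ (dx * dy)) • mul y x

/-- The Jordan superidentity, for all homogeneous `w, x, y, z`. -/
def SatisfiesJordanSuperId (mul : J F → J F → J F) : Prop :=
  ∀ w x y z : J F, ∀ dw dx dy dz : ℕ,
    IsHomog F w dw → IsHomog F x dx → IsHomog F y dy → IsHomog F z dz →
    mul (mul w x) (mul y z)
      + ((-1 : F) ^ (dx * dy)) • mul (mul w y) (mul x z)
      + ((-1 : F) ^ ((dx + dy) * dz)) • mul (mul w z) (mul x y)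
      - ((-1 : F) ^ (dw * dx)) • mul x (mul w (mul y z))
      - ((-1 : F) ^ (dy * (dw + dx))) • mul y (mul w (mul x z))
      - ((-1 : F) ^ (dz * (dw + dx + dy))) • mul z (mul w (mul x y)) = 0

/-- `F(a,b,c,d) = h((ab)c, d) + h(ab,c)·d + (h(a,b)·c)·d`. -/
def Fc (mul : J F → J F → J F) (h : J F →ₗ[F] J F →ₗ[F] J F) (a b c d : J F) : J F :=
  h (mul (mul a b) c) d + mul (h (mul a b) c) d + mul (mul (h a b) c) d

/-- `G(a,b,c,d) = h(ab, cd) + h(a,b)·(cd) + (ab)·h(c,d)`. -/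
def Gc (mul : J F → J F → J F) (h : J F →ₗ[F] J F →ₗ[F] J F) (a b c d : J F) : J F :=
  h (mul a b) (mul c d) + mul (h a b) (mul c d) + mul (mul a b) (h c d)

/-- Supersymmetry of `h`: `h(a,b) = (−1)^{|a||b|} h(b,a)` for homogeneous `a, b`. -/
def IsSuperSym (h : J F →ₗ[F] J F →ₗ[F] J F) : Prop :=
  ∀ a b : J F, ∀ da db : ℕ, IsHomog F a da → IsHomog F b db →
    h a b = ((-1 : F) ^ (da * db)) • h b a

/-- The 2-cocycle identity for `h` with respect to the multiplication `mul`. -/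
def IsCocycleId (mul : J F → J F → J F) (h : J F →ₗ[F] J F →ₗ[F] J F) : Prop :=
  ∀ a b c d : J F, ∀ da db dc dd : ℕ,
    IsHomog F a da → IsHomog F b db → IsHomog F c dc → IsHomog F d dd →
    Fc F mul h a b c d + ((-1 : F) ^ (db * (dc + dd) + dc * dd)) • Fc F mul h a d c b
      + ((-1 : F) ^ (da * (db + dc + dd) + dc * dd)) • Fc F mul h b d c a
    = Gc F mul h a b c d + ((-1 : F) ^ (db * dc)) • Gc F mul h a c b d
      + ((-1 : F) ^ (dd * (dc + db))) • Gc F mul h a d b c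

/-- `h` is a supersymmetric 2-cocycle. -/
def IsSuperCocycle (mul : J F → J F → J F) (h : J F →ₗ[F] J F →ₗ[F] J F) : Prop :=
  IsSuperSym F h ∧ IsCocycleId F mul h

/-- `h` is a coboundary: `h(a,b) = a·μ(b) + μ(a)·b − μ(a·b)` for some linear `μ`. -/
def IsCoboundary (mul : J F → J F → J F) (h : J F →ₗ[F] J F →ₗ[F] J F) : Prop :=
  ∃ μ : J F →ₗ[F] J F, ∀ a b : J F, h a b = mul a (μ b) + mul (μ a) b - μ (mul a b)

/-- The bilinear map `h` is even: `h(J_i × J_j) ⊆ J_{i+j}`. -/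
def IsEvenBilin (h : J F →ₗ[F] J F →ₗ[F] J F) : Prop :=
  (∀ a ∈ J0 F, ∀ b ∈ J0 F, h a b ∈ J0 F) ∧
  (∀ a ∈ J0 F, ∀ b ∈ J1 F, h a b ∈ J1 F) ∧
  (∀ a ∈ J1 F, ∀ b ∈ J0 F, h a b ∈ J1 F) ∧
  (∀ a ∈ J1 F, ∀ b ∈ J1 F, h a b ∈ J0 F)

/-- The linear map `μ` is even: `μ(J_i) ⊆ J_i`. -/
def IsEvenLin (μ : J F →ₗ[F] J F) : Prop :=
  (∀ a ∈ J0 F, μ a ∈ J0 F) ∧ (∀ a ∈ J1 F, μ a ∈ J1 F)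

/-- `φ` is a graded algebra isomorphism from `(J, mulA)` onto `(J, mulB)`. -/
def IsGradedIso (mulA mulB : J F → J F → J F) (φ : J F → J F) : Prop :=
  IsLinearMap F φ ∧ Function.Bijective φ ∧
  φ '' (J0 F : Set (J F)) = (J0 F : Set (J F)) ∧
  φ '' (J1 F : Set (J F)) = (J1 F : Set (J F)) ∧
  ∀ x y : J F, φ (mulA x y) = mulB (φ x) (φ y)

/-- `D_γ`: `e₁²=e₁`, `e₂²=e₂`, `eᵢfⱼ = ½fⱼ`, `f₁f₂ = e₁ + γe₂`. -/
def mulD (γ : F) (x y : J F) : J F :=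
  ![x 0 * y 0 + (x 2 * y 3 - x 3 * y 2),
    x 1 * y 1 + γ * (x 2 * y 3 - x 3 * y 2),
    ((x 0 + x 1) * y 2 + x 2 * (y 0 + y 1)) / 2,
    ((x 0 + x 1) * y 3 + x 3 * (y 0 + y 1)) / 2]

/-- `(2,2)₁`: `e₁²=e₁`, `e₂²=e₂`. -/
def mul1 (x y : J F) : J F :=
  ![x 0 * y 0, x 1 * y 1, 0, 0]

/-- `(2,2)₃`: `e₁²=e₁`, `e₂²=e₂`, `e₁f₁=½f₁`, `e₁f₂=½f₂`, `f₁f₂=e₁`. -/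
def mul3 (x y : J F) : J F :=
  ![x 0 * y 0 + (x 2 * y 3 - x 3 * y 2), x 1 * y 1,
    (x 0 * y 2 + x 2 * y 0) / 2, (x 0 * y 3 + x 3 * y 0) / 2]

/-- `(2,2)₅`: `e₁²=e₁`, `e₂²=e₂`, `e₁f₁=f₁`, `e₁f₂=f₂`, `f₁f₂=e₁`. -/
def mul5 (x y : J F) : J F :=
  ![x 0 * y 0 + (x 2 * y 3 - x 3 * y 2), x 1 * y 1,
    x 0 * y 2 + x 2 * y 0, x 0 * y 3 + x 3 * y 0]

/-- `(2,2)₇`: `e₁²=e₁`, `e₂²=e₂`, `eᵢfⱼ=½fⱼ`, `f₁f₂=e₂`. -/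
def mul7 (x y : J F) : J F :=
  ![x 0 * y 0, x 1 * y 1 + (x 2 * y 3 - x 3 * y 2),
    ((x 0 + x 1) * y 2 + x 2 * (y 0 + y 1)) / 2,
    ((x 0 + x 1) * y 3 + x 3 * (y 0 + y 1)) / 2]

/-- `(2,2)₈`: `e₁²=e₁`, `e₂²=e₂`, `e₁f₁=½f₁`. -/
def mul8 (x y : J F) : J F :=
  ![x 0 * y 0, x 1 * y 1, (x 0 * y 2 + x 2 * y 0) / 2, 0]

/-- `(2,2)₂₆`: `e₁²=e₁`, `e₁f₁=½f₁`, `e₁f₂=½f₂`, `f₁f₂=e₁+e₂`. -/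
def mul26 (x y : J F) : J F :=
  ![x 0 * y 0 + (x 2 * y 3 - x 3 * y 2), x 2 * y 3 - x 3 * y 2,
    (x 0 * y 2 + x 2 * y 0) / 2, (x 0 * y 3 + x 3 * y 0) / 2]

/-- `(2,2)₄₃`: `e₁²=e₁`, `e₁e₂=e₂`, `e₁f₁=f₁`, `e₁f₂=f₂`, `f₁f₂=e₁+e₂`. -/
def mul43 (x y : J F) : J F :=
  ![x 0 * y 0 + (x 2 * y 3 - x 3 * y 2),
    x 0 * y 1 + x 1 * y 0 + (x 2 * y 3 - x 3 * y 2),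
    x 0 * y 2 + x 2 * y 0, x 0 * y 3 + x 3 * y 0]

/-- `(2,2)₅₂`: `e₁²=e₁`, `e₁e₂=½e₂`. -/
def mul52 (x y : J F) : J F :=
  ![x 0 * y 0, (x 0 * y 1 + x 1 * y 0) / 2, 0, 0]

/-- `(2,2)₅₇`: `e₁²=e₁`, `e₁e₂=½e₂`, `e₁f₂=f₂`. -/
def mul57 (x y : J F) : J F :=
  ![x 0 * y 0, (x 0 * y 1 + x 1 * y 0) / 2, 0, x 0 * y 3 + x 3 * y 0]

/-- `(2,2)₆₀`: `e₁²=e₁`, `e₁e₂=½e₂`, `e₁f₁=½f₁`, `e₁f₂=½f₂`. -/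
def mul60 (x y : J F) : J F :=
  ![x 0 * y 0, (x 0 * y 1 + x 1 * y 0) / 2,
    (x 0 * y 2 + x 2 * y 0) / 2, (x 0 * y 3 + x 3 * y 0) / 2]

/-- `(2,2)₆₇`: `e₁²=e₁`, `e₁e₂=½e₂`, `e₁f₁=f₁`, `e₁f₂=f₂`. -/
def mul67 (x y : J F) : J F :=
  ![x 0 * y 0, (x 0 * y 1 + x 1 * y 0) / 2,
    x 0 * y 2 + x 2 * y 0, x 0 * y 3 + x 3 * y 0]


set_option linter.all false
set_option linter.unusedSectionVars false
set_option linter.unusedSimpArgs false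

theorem vec4_ext {x y : J F} (h0 : x 0 = y 0) (h1 : x 1 = y 1) (h2 : x 2 = y 2)
    (h3 : x 3 = y 3) : x = y := by
  funext i
  fin_cases i <;> assumption

/-- Multiplication table of `(2,2)₅` applied to arbitrary elements is read off in coordinates;
every vector is the combination of the four basis vectors. -/
theorem vec_eq (x : J F) :
    x = x 0 • e1 F + x 1 • e2 F + x 2 • f1 F + x 3 • f2 F := by
  funext i
  fin_cases i <;> simp [e1, e2, f1, f2]

theorem hE1 : IsHomog F (e1 F) 0 := Or.inl ⟨rfl, Submodule.subset_span (by simp)⟩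
theorem hE2 : IsHomog F (e2 F) 0 := Or.inl ⟨rfl, Submodule.subset_span (by simp)⟩
theorem hF1 : IsHomog F (f1 F) 1 := Or.inr ⟨rfl, Submodule.subset_span (by simp)⟩
theorem hF2 : IsHomog F (f2 F) 1 := Or.inr ⟨rfl, Submodule.subset_span (by simp)⟩

theorem m00 : mul5 F (e1 F) (e1 F) = e1 F := by
  funext i; fin_cases i <;> simp [mul5, e1, e2, f1, f2]
theorem m01 : mul5 F (e1 F) (e2 F) = 0 := by
  funext i; fin_cases i <;> simp [mul5, e1, e2, f1, f2]
theorem m02 : mul5 F (e1 F) (f1 F) = f1 F := by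
  funext i; fin_cases i <;> simp [mul5, e1, e2, f1, f2]
theorem m03 : mul5 F (e1 F) (f2 F) = f2 F := by
  funext i; fin_cases i <;> simp [mul5, e1, e2, f1, f2]
theorem m10 : mul5 F (e2 F) (e1 F) = 0 := by
  funext i; fin_cases i <;> simp [mul5, e1, e2, f1, f2]
theorem m11 : mul5 F (e2 F) (e2 F) = e2 F := by
  funext i; fin_cases i <;> simp [mul5, e1, e2, f1, f2]
theorem m12 : mul5 F (e2 F) (f1 F) = 0 := by
  funext i; fin_cases i <;> simp [mul5, e1, e2, f1, f2]
theorem m13 : mul5 F (e2 F) (f2 F) = 0 := by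
  funext i; fin_cases i <;> simp [mul5, e1, e2, f1, f2]
theorem m20 : mul5 F (f1 F) (e1 F) = f1 F := by
  funext i; fin_cases i <;> simp [mul5, e1, e2, f1, f2]
theorem m21 : mul5 F (f1 F) (e2 F) = 0 := by
  funext i; fin_cases i <;> simp [mul5, e1, e2, f1, f2]
theorem m22 : mul5 F (f1 F) (f1 F) = 0 := by
  funext i; fin_cases i <;> simp [mul5, e1, e2, f1, f2]
theorem m23 : mul5 F (f1 F) (f2 F) = e1 F := by
  funext i; fin_cases i <;> simp [mul5, e1, e2, f1, f2]
theorem m30 : mul5 F (f2 F) (e1 F) = f2 F := by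
  funext i; fin_cases i <;> simp [mul5, e1, e2, f1, f2]
theorem m31 : mul5 F (f2 F) (e2 F) = 0 := by
  funext i; fin_cases i <;> simp [mul5, e1, e2, f1, f2]
theorem m32 : mul5 F (f2 F) (f1 F) = -e1 F := by
  funext i; fin_cases i <;> simp [mul5, e1, e2, f1, f2]
theorem m33 : mul5 F (f2 F) (f2 F) = 0 := by
  funext i; fin_cases i <;> simp [mul5, e1, e2, f1, f2]
theorem mul_z (x : J F) : mul5 F x 0 = 0 := by
  funext i; fin_cases i <;> simp [mul5]
theorem z_mul (x : J F) : mul5 F 0 x = 0 := by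
  funext i; fin_cases i <;> simp [mul5]
theorem n_mul (x y : J F) : mul5 F (-x) y = - mul5 F x y := by
  funext i; fin_cases i <;> simp [mul5] <;> ring
theorem mul_n (x y : J F) : mul5 F x (-y) = - mul5 F x y := by
  funext i; fin_cases i <;> simp [mul5] <;> ring
theorem r0 (x : J F) : mul5 F x (e1 F) = ![x 0, 0, x 2, x 3] := by
  funext i; fin_cases i <;> simp [mul5, e1, e2, f1, f2]
theorem l0 (x : J F) : mul5 F (e1 F) x = ![x 0, 0, x 2, x 3] := by
  funext i; fin_cases i <;> simp [mul5, e1, e2, f1, f2]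
theorem r1 (x : J F) : mul5 F x (e2 F) = ![0, x 1, 0, 0] := by
  funext i; fin_cases i <;> simp [mul5, e1, e2, f1, f2]
theorem l1 (x : J F) : mul5 F (e2 F) x = ![0, x 1, 0, 0] := by
  funext i; fin_cases i <;> simp [mul5, e1, e2, f1, f2]
theorem r2 (x : J F) : mul5 F x (f1 F) = ![-x 3, 0, x 0, 0] := by
  funext i; fin_cases i <;> simp [mul5, e1, e2, f1, f2]
theorem l2 (x : J F) : mul5 F (f1 F) x = ![x 3, 0, x 0, 0] := by
  funext i; fin_cases i <;> simp [mul5, e1, e2, f1, f2]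
theorem r3 (x : J F) : mul5 F x (f2 F) = ![x 2, 0, 0, x 0] := by
  funext i; fin_cases i <;> simp [mul5, e1, e2, f1, f2]
theorem l3 (x : J F) : mul5 F (f2 F) x = ![-x 2, 0, 0, x 0] := by
  funext i; fin_cases i <;> simp [mul5, e1, e2, f1, f2]

theorem table (h : J F →ₗ[F] J F →ₗ[F] J F) (hc : IsSuperCocycle F (mul5 F) h) :
    h (e1 F) (e1 F) = ![h (f2 F) (e1 F) 3, -h (f2 F) (f1 F) 1, 0, 0] ∧
    h (e1 F) (e2 F) = ![h (f2 F) (e2 F) 3, h (f2 F) (f1 F) 1, 0, 0] ∧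
    h (e1 F) (f1 F) = ![0, -h (f1 F) (e2 F) 1, h (f2 F) (e1 F) 3, 0] ∧
    h (e1 F) (f2 F) = ![0, -h (f2 F) (e2 F) 1, 0, h (f2 F) (e1 F) 3] ∧
    h (e2 F) (e1 F) = ![h (f2 F) (e2 F) 3, h (f2 F) (f1 F) 1, 0, 0] ∧
    h (e2 F) (e2 F) = ![-h (f2 F) (e2 F) 3, h (e2 F) (e2 F) 1, 0, 0] ∧
    h (e2 F) (f1 F) = ![0, h (f1 F) (e2 F) 1, h (f2 F) (e2 F) 3, 0] ∧
    h (e2 F) (f2 F) = ![0, h (f2 F) (e2 F) 1, 0, h (f2 F) (e2 F) 3] ∧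
    h (f1 F) (e1 F) = ![0, -h (f1 F) (e2 F) 1, h (f2 F) (e1 F) 3, 0] ∧
    h (f1 F) (e2 F) = ![0, h (f1 F) (e2 F) 1, h (f2 F) (e2 F) 3, 0] ∧
    h (f1 F) (f1 F) = ![0, 0, 0, 0] ∧
    h (f1 F) (f2 F) = ![-h (f2 F) (f1 F) 0, -h (f2 F) (f1 F) 1, 0, 0] ∧
    h (f2 F) (e1 F) = ![0, -h (f2 F) (e2 F) 1, 0, h (f2 F) (e1 F) 3] ∧
    h (f2 F) (e2 F) = ![0, h (f2 F) (e2 F) 1, 0, h (f2 F) (e2 F) 3] ∧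
    h (f2 F) (f1 F) = ![h (f2 F) (f1 F) 0, h (f2 F) (f1 F) 1, 0, 0] ∧
    h (f2 F) (f2 F) = ![0, 0, 0, 0] := by
  obtain ⟨hs, hc⟩ := hc
  have s01 := hs _ _ _ _ (hE1 F) (hE2 F)
  have s02 := hs _ _ _ _ (hE1 F) (hF1 F)
  have s03 := hs _ _ _ _ (hE1 F) (hF2 F)
  have s12 := hs _ _ _ _ (hE2 F) (hF1 F)
  have s13 := hs _ _ _ _ (hE2 F) (hF2 F)
  have s22 := hs _ _ _ _ (hF1 F) (hF1 F)
  have s23 := hs _ _ _ _ (hF1 F) (hF2 F)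
  have s33 := hs _ _ _ _ (hF2 F) (hF2 F)
  have k1 := hc _ _ _ _ _ _ _ _ (hE1 F) (hE1 F) (hE1 F) (hE2 F)
  have k2 := hc _ _ _ _ _ _ _ _ (hE1 F) (hE1 F) (hE1 F) (hF1 F)
  have k3 := hc _ _ _ _ _ _ _ _ (hE1 F) (hE1 F) (hE1 F) (hF2 F)
  have k4 := hc _ _ _ _ _ _ _ _ (hE1 F) (hE1 F) (hE2 F) (hE2 F)
  have k5 := hc _ _ _ _ _ _ _ _ (hE1 F) (hE1 F) (hE2 F) (hF1 F)
  have k6 := hc _ _ _ _ _ _ _ _ (hE1 F) (hE1 F) (hE2 F) (hF2 F)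
  have k7 := hc _ _ _ _ _ _ _ _ (hE1 F) (hE1 F) (hF1 F) (hE1 F)
  have k8 := hc _ _ _ _ _ _ _ _ (hE1 F) (hE1 F) (hF1 F) (hE2 F)
  have k9 := hc _ _ _ _ _ _ _ _ (hE1 F) (hE1 F) (hF1 F) (hF2 F)
  have k10 := hc _ _ _ _ _ _ _ _ (hE1 F) (hE1 F) (hF2 F) (hE2 F)
  have k11 := hc _ _ _ _ _ _ _ _ (hF1 F) (hE1 F) (hF1 F) (hF2 F)
  have k12 := hc _ _ _ _ _ _ _ _ (hF2 F) (hE1 F) (hF1 F) (hF2 F)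
  simp only [Fc, Gc, m00, m01, m02, m03, m10, m11, m12, m13, m20, m21, m22, m23, m30, m31, m32, m33, mul_z, z_mul, n_mul, mul_n, map_zero, map_neg, LinearMap.zero_apply, LinearMap.neg_apply] at s01 s02 s03 s12 s13 s22 s23 s33 k1 k2 k3 k4 k5 k6 k7 k8 k9 k10 k11 k12
  simp only [r0, l0, r1, l1, r2, l2, r3, l3, mul_z, z_mul] at s01 s02 s03 s12 s13 s22 s23 s33 k1 k2 k3 k4 k5 k6 k7 k8 k9 k10 k11 k12
  have k10_0 := congrFun k10 0
  have k10_1 := congrFun k10 1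
  have k11_0 := congrFun k11 0
  have k12_0 := congrFun k12 0
  have k1_1 := congrFun k1 1
  have k2_0 := congrFun k2 0
  have k2_2 := congrFun k2 2
  have k2_3 := congrFun k2 3
  have k3_0 := congrFun k3 0
  have k3_2 := congrFun k3 2
  have k3_3 := congrFun k3 3
  have k4_0 := congrFun k4 0
  have k4_2 := congrFun k4 2
  have k4_3 := congrFun k4 3
  have k5_0 := congrFun k5 0
  have k5_2 := congrFun k5 2
  have k5_3 := congrFun k5 3
  have k6_0 := congrFun k6 0
  have k6_2 := congrFun k6 2
  have k6_3 := congrFun k6 3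
  have k7_0 := congrFun k7 0
  have k8_0 := congrFun k8 0
  have k8_1 := congrFun k8 1
  have k9_1 := congrFun k9 1
  have k9_2 := congrFun k9 2
  have s01_0 := congrFun s01 0
  have s01_1 := congrFun s01 1
  have s01_2 := congrFun s01 2
  have s01_3 := congrFun s01 3
  have s02_0 := congrFun s02 0
  have s02_1 := congrFun s02 1
  have s02_2 := congrFun s02 2
  have s02_3 := congrFun s02 3
  have s03_0 := congrFun s03 0
  have s03_1 := congrFun s03 1
  have s03_2 := congrFun s03 2
  have s03_3 := congrFun s03 3
  have s12_0 := congrFun s12 0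
  have s12_1 := congrFun s12 1
  have s12_2 := congrFun s12 2
  have s12_3 := congrFun s12 3
  have s13_0 := congrFun s13 0
  have s13_1 := congrFun s13 1
  have s13_2 := congrFun s13 2
  have s13_3 := congrFun s13 3
  have s22_0 := congrFun s22 0
  have s22_1 := congrFun s22 1
  have s22_2 := congrFun s22 2
  have s22_3 := congrFun s22 3
  have s23_0 := congrFun s23 0
  have s23_1 := congrFun s23 1
  have s23_2 := congrFun s23 2
  have s23_3 := congrFun s23 3
  have s33_0 := congrFun s33 0
  have s33_1 := congrFun s33 1
  have s33_2 := congrFun s33 2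
  have s33_3 := congrFun s33 3
  simp only [Pi.add_apply, Pi.smul_apply, Pi.neg_apply, Pi.zero_apply, smul_eq_mul, neg_zero,
    Matrix.cons_val] at k10_0 k10_1 k11_0 k12_0 k1_1 k2_0 k2_2 k2_3 k3_0 k3_2 k3_3 k4_0 k4_2 k4_3 k5_0 k5_2 k5_3 k6_0 k6_2 k6_3 k7_0 k8_0 k8_1 k9_1 k9_2 s01_0 s01_1 s01_2 s01_3 s02_0 s02_1 s02_2 s02_3 s03_0 s03_1 s03_2 s03_3 s12_0 s12_1 s12_2 s12_3 s13_0 s13_1 s13_2 s13_3 s22_0 s22_1 s22_2 s22_3 s23_0 s23_1 s23_2 s23_3 s33_0 s33_1 s33_2 s33_3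
  clear hs hc s01 s02 s03 s12 s13 s22 s23 s33 k1 k2 k3 k4 k5 k6 k7 k8 k9 k10 k11 k12
  refine ⟨?_, ?_, ?_, ?_, ?_, ?_, ?_, ?_, ?_, ?_, ?_, ?_, ?_, ?_, ?_, ?_⟩
  · refine vec4_ext F ?_ ?_ ?_ ?_ <;> simp only [Matrix.cons_val]
    · linear_combination (-1) * k3_3 + (-2) * s03_3
    · linear_combination k9_1
    · linear_combination k3_0 + (1/2) * k9_2 + (3) * s03_0 + (1/2) * s23_2
    · linear_combination (-1/2) * k7_0 + (-1/2) * s02_0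
  · refine vec4_ext F ?_ ?_ ?_ ?_ <;> simp only [Matrix.cons_val]
    · linear_combination (-1) * k6_3 + (-1) * s13_3
    · linear_combination k1_1 + (-1) * k9_1
    · linear_combination (1/2) * k10_0
    · linear_combination (-1/2) * k8_0
  · refine vec4_ext F ?_ ?_ ?_ ?_ <;> simp only [Matrix.cons_val]
    · linear_combination k2_0 + (-1/2) * k7_0 + (5/2) * s02_0
    · linear_combination k8_1
    · linear_combination k2_2 + (-1) * k3_3 + (3) * s02_2 + (-2) * s03_3
    · linear_combination k2_3 + (3) * s02_3
  · refine vec4_ext F ?_ ?_ ?_ ?_ <;> simp only [Matrix.cons_val]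
    · linear_combination (-1/2) * k9_2 + (-1/2) * s23_2
    · linear_combination k10_1
    · linear_combination k3_2 + (3) * s03_2
    · linear_combination s03_3
  · refine vec4_ext F ?_ ?_ ?_ ?_ <;> simp only [Matrix.cons_val]
    · linear_combination (-1) * k6_3 + (-1) * s01_0 + (-1) * s13_3
    · linear_combination k1_1 + (-1) * k9_1 + (-1) * s01_1
    · linear_combination (1/2) * k10_0 + (-1) * s01_2
    · linear_combination (-1/2) * k8_0 + (-1) * s01_3
  · refine vec4_ext F ?_ ?_ ?_ ?_ <;> simp only [Matrix.cons_val]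
    · linear_combination (-1) * k4_0 + k6_3 + s13_3
    · linear_combination (-1/2) * k10_0 + (-1) * k4_2
    · linear_combination (-1) * k4_3 + (1/2) * k8_0
  · refine vec4_ext F ?_ ?_ ?_ ?_ <;> simp only [Matrix.cons_val]
    · linear_combination k5_0 + (-1/2) * k8_0 + (2) * s12_0
    · linear_combination s12_1
    · linear_combination k5_2 + (-1) * k6_3 + (2) * s12_2 + (-1) * s13_3
    · linear_combination k5_3 + (2) * s12_3
  · refine vec4_ext F ?_ ?_ ?_ ?_ <;> simp only [Matrix.cons_val]
    · linear_combination (-1/2) * k10_0 + k6_0 + (2) * s13_0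
    · linear_combination s13_1
    · linear_combination k6_2 + (2) * s13_2
    · linear_combination s13_3
  · refine vec4_ext F ?_ ?_ ?_ ?_ <;> simp only [Matrix.cons_val]
    · linear_combination k2_0 + (-1/2) * k7_0 + (3/2) * s02_0
    · linear_combination k8_1 + (-1) * s02_1
    · linear_combination k2_2 + (-1) * k3_3 + (2) * s02_2 + (-2) * s03_3
    · linear_combination k2_3 + (2) * s02_3
  · refine vec4_ext F ?_ ?_ ?_ ?_ <;> simp only [Matrix.cons_val]
    · linear_combination k5_0 + (-1/2) * k8_0 + s12_0
    · linear_combination k5_2 + (-1) * k6_3 + s12_2 + (-1) * s13_3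
    · linear_combination k5_3 + s12_3
  · refine vec4_ext F ?_ ?_ ?_ ?_ <;> simp only [Matrix.cons_val]
    · linear_combination (1/2) * s22_0
    · linear_combination (1/2) * s22_1
    · linear_combination (1/2) * s22_2
    · linear_combination (1/2) * s22_3
  · refine vec4_ext F ?_ ?_ ?_ ?_ <;> simp only [Matrix.cons_val]
    · linear_combination s23_0
    · linear_combination s23_1
    · linear_combination (1/2) * k12_0 + (-1/2) * s03_0 + (1/2) * s23_2
    · linear_combination (-1/2) * k11_0 + s02_0 + (1/2) * s23_3
  · refine vec4_ext F ?_ ?_ ?_ ?_ <;> simp only [Matrix.cons_val]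
    · linear_combination (-1/2) * k9_2 + (-1) * s03_0 + (-1/2) * s23_2
    · linear_combination k10_1 + (-1) * s03_1
    · linear_combination k3_2 + (2) * s03_2
  · refine vec4_ext F ?_ ?_ ?_ ?_ <;> simp only [Matrix.cons_val]
    · linear_combination (-1/2) * k10_0 + k6_0 + s13_0
    · linear_combination k6_2 + s13_2
  · refine vec4_ext F ?_ ?_ ?_ ?_ <;> simp only [Matrix.cons_val]
    · linear_combination (-1/2) * k12_0 + (1/2) * s03_0 + (1/2) * s23_2
    · linear_combination (1/2) * k11_0 + (-1) * s02_0 + (1/2) * s23_3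
  · refine vec4_ext F ?_ ?_ ?_ ?_ <;> simp only [Matrix.cons_val]
    · linear_combination (1/2) * s33_0
    · linear_combination (1/2) * s33_1
    · linear_combination (1/2) * s33_2
    · linear_combination (1/2) * s33_3

/-- every supersymmetric 2-cocycle of `(2,2)₅` is a coboundary,
i.e. `H²(J, J) = 0`. -/
theorem H2_vanishes_mul5 (h : J F →ₗ[F] J F →ₗ[F] J F)
    (hc : IsSuperCocycle F (mul5 F) h) :
    IsCoboundary F (mul5 F) h := by
  obtain ⟨t00, t01, t02, t03, t10, t11, t12, t13, t20, t21, t22, t23, t30, t31, t32, t33⟩ :=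
    table F h hc
  generalize h (e2 F) (e2 F) 1 = a1 at *
  generalize h (f1 F) (e2 F) 1 = a2 at *
  generalize h (f2 F) (e1 F) 3 = a3 at *
  generalize h (f2 F) (e2 F) 1 = a4 at *
  generalize h (f2 F) (e2 F) 3 = a5 at *
  generalize h (f2 F) (f1 F) 0 = a6 at *
  generalize h (f2 F) (f1 F) 1 = a7 at *
  refine ⟨{ toFun := fun x => ![a3 * x 0 + a5 * x 1, a7 * x 0 + a1 * x 1 + a2 * x 2 + a4 * x 3,
      (a3 - a6) * x 2, 0], map_add' := ?_, map_smul' := ?_ }, ?_⟩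
  · intro x y
    funext i; fin_cases i <;> simp <;> ring
  · intro c x
    funext i; fin_cases i <;> simp <;> ring
  · intro x y
    have key : h x y = h (x 0 • e1 F + x 1 • e2 F + x 2 • f1 F + x 3 • f2 F)
        (y 0 • e1 F + y 1 • e2 F + y 2 • f1 F + y 3 • f2 F) := by
      rw [← vec_eq, ← vec_eq]
    rw [key]
    simp only [map_add, map_smul, LinearMap.add_apply, LinearMap.smul_apply, t00, t01, t02, t03,
      t10, t11, t12, t13, t20, t21, t22, t23, t30, t31, t32, t33]
    funext i
    fin_cases i <;> simp [mul5] <;> ring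

end JS22
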